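/- If 0 > t_1 > t_2 > ⋯ > t_{n+1} and α ≥ 0, then A^{(q,α)} J is strictly totally positive, where A^{(q,α)} := (A_{j-1}^{(q,α)}(t_i)) is the collocation matrix of the q-Abel basis and J := diag((-1)^{i-1}). -/

import Mathlib

open Finset Matrix

noncomputable def qInt (q : ℝ) (m : ℕ) : ℝ := ∑ i ∈ Finset.range m, q ^ i

noncomputable def qFact (q : ℝ) (m : ℕ) : ℝ := ∏ i ∈ Finset.range m, qInt q (i + 1)

noncomputable def qBinom (q : ℝ) (m k : ℕ) : ℝ :=
  if k ≤ m then qFact q m / (qFact q k * qFact q (m - k)) else 0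

noncomputable def qAbel (q α : ℝ) (m : ℕ) (x : ℝ) : ℝ :=
  if m = 0 then 1 else x * ∏ j ∈ Finset.Icc 1 (m - 1), (x * q ^ j - α * qInt q m)

def IsTotallyPos {n : ℕ} (A : Matrix (Fin n) (Fin n) ℝ) : Prop :=
  ∀ (k : ℕ) (f g : Fin k → Fin n), StrictMono f → StrictMono g →
    0 ≤ (A.submatrix f g).det

def IsStrictTotallyPos {n : ℕ} (A : Matrix (Fin n) (Fin n) ℝ) : Prop :=
  ∀ (k : ℕ) (f g : Fin k → Fin n), StrictMono f → StrictMono g →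
    0 < (A.submatrix f g).det

noncomputable def Jmat (n : ℕ) : Matrix (Fin (n + 1)) (Fin (n + 1)) ℝ :=
  Matrix.diagonal fun i => (-1 : ℝ) ^ (i : ℕ)

open Polynomial in
lemma signVar_lt_card (P : ℝ[X]) (hP : P ≠ 0) : P.signVariations + 1 ≤ P.support.card := by
  induction h : P.support.card using Nat.strong_induction_on generalizing P with
  | _ c ih =>
    subst h
    have h1 := Polynomial.eraseLead_support_card_lt hP
    by_cases h0 : P.eraseLead = 0
    · have h2 := Polynomial.eraseLead_add_monomial_natDegree_leadingCoeff P
      rw [h0, zero_add] at h2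
      have h3 : P.signVariations = 0 := by
        rw [← h2]; exact signVariations_monomial _ _
      rw [h3]
      have : P.support.Nonempty := by simpa using hP
      have := this.card_pos
      omega
    · have h3 := ih _ h1 _ h0 rfl
      have h4 := signVariations_le_eraseLead_succ (P := P)
      omega

/-- A sparse polynomial cannot have too many positive roots. -/
lemma sparse_ne_zero (k : ℕ) (g : Fin (k + 1) → ℕ) (c : Fin (k + 1) → ℝ)
    (P : Polynomial ℝ) (hPdef : P = ∑ j, Polynomial.monomial (g j) (c j)) (hP : P ≠ 0)
    (S : Finset ℝ) (hS : ∀ x ∈ S, 0 < x ∧ P.eval x = 0) : S.card ≤ k := by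
  have h1 := signVar_lt_card P hP
  have h2 := Polynomial.roots_countP_pos_le_signVariations (P := P)
  have h3 : P.support.card ≤ k + 1 := by
    have : P.support ⊆ Finset.univ.image g := by
      intro m hm
      rw [Polynomial.mem_support_iff, hPdef, Polynomial.finsetSum_coeff] at hm
      obtain ⟨j, _, hj⟩ := Finset.exists_ne_zero_of_sum_ne_zero hm
      rw [Polynomial.coeff_monomial] at hj
      simp only [Finset.mem_image, Finset.mem_univ, true_and]
      refine ⟨j, ?_⟩
      by_contra hne
      simp [hne] at hj
    calc _ ≤ _ := Finset.card_le_card this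
      _ ≤ _ := Finset.card_image_le
      _ = _ := by simp
  have h4 : S.val ≤ P.roots.filter (0 < ·) := by
    rw [Multiset.le_iff_subset S.nodup]
    intro x hx
    have := hS x hx
    rw [Multiset.mem_filter, Polynomial.mem_roots hP]
    exact ⟨this.2, this.1⟩
  have h5 := Multiset.card_le_card h4
  rw [← Multiset.countP_eq_card_filter] at h5
  change S.card ≤ _ at h5
  omega

/-- Generalized Vandermonde determinants are positive. -/
lemma genVand_pos (k : ℕ) : ∀ (s : Fin k → ℝ) (g : Fin k → ℕ), (∀ i, 0 < s i) → StrictMono s →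
    StrictMono g → 0 < (Matrix.of fun i j => s i ^ g j).det := by
  induction k with
  | zero => intro s g _ _ _; simp
  | succ k ih =>
    intro s g hs0 hs hg
    set B : Fin (k + 1) → ℝ := fun j => (-1) ^ (k + (j : ℕ)) *
      (Matrix.of fun (i i' : Fin k) => s i.castSucc ^ g (j.succAbove i')).det with hB
    have hexp : ∀ x : ℝ, (Matrix.of fun (i j : Fin (k + 1)) =>
        (Fin.snoc (α := fun _ => ℝ) (fun i : Fin k => s i.castSucc) x : Fin (k + 1) → ℝ) i ^ g j).det
        = ∑ j, B j * x ^ g j := by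
      intro x
      rw [Matrix.det_succ_row _ (Fin.last k)]
      refine Finset.sum_congr rfl fun j _ => ?_
      simp only [hB, Matrix.of_apply, Fin.snoc_last, Fin.val_last]
      rw [mul_assoc, mul_assoc, mul_comm (x ^ g j)]
      congr 3
      ext i i'
      simp [Matrix.submatrix_apply]
    have hBl : 0 < B (Fin.last k) := by
      simp only [hB, Fin.val_last, ← two_mul, pow_mul]
      norm_num
      exact ih (fun i => s i.castSucc) (fun i => g i.castSucc) (fun i => hs0 _)
        (hs.comp (Fin.strictMono_castSucc)) (hg.comp (Fin.strictMono_castSucc))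
    set P : Polynomial ℝ := ∑ j, Polynomial.monomial (g j) (B j) with hPdef
    have hPe : ∀ x, P.eval x = ∑ j, B j * x ^ g j := by
      intro x; simp [hPdef, Polynomial.eval_finsetSum]
    have hPc : P.coeff (g (Fin.last k)) = B (Fin.last k) := by
      rw [hPdef, Polynomial.finsetSum_coeff, Finset.sum_eq_single (Fin.last k)]
      · simp
      · intro j _ hj
        rw [Polynomial.coeff_monomial, if_neg]
        exact fun h => hj (hg.injective h)
      · simp
    have hP : P ≠ 0 := by
      intro h; rw [h] at hPc; simp at hPc; linarith
    have hdeg : P.natDegree = g (Fin.last k) := by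
      apply le_antisymm
      · refine Polynomial.natDegree_sum_le_of_forall_le _ _ ?_
        intro j _
        exact (Polynomial.natDegree_monomial_le _).trans (hg.monotone (Fin.le_last j))
      · exact Polynomial.le_natDegree_of_ne_zero (by rw [hPc]; exact hBl.ne')
    have hlead : P.leadingCoeff = B (Fin.last k) := by
      rw [Polynomial.leadingCoeff, hdeg, hPc]
    have hroot : ∀ i : Fin k, P.eval (s i.castSucc) = 0 := by
      intro i
      rw [hPe, ← hexp]
      refine Matrix.det_zero_of_row_eq (Fin.castSucc_lt_last i).ne ?_
      ext j
      simp
    have hnoroot : ∀ x, s (Fin.last k) ≤ x → P.eval x ≠ 0 := by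
      intro x hx h0
      have hlt : ∀ i : Fin k, s i.castSucc < x := fun i =>
        lt_of_lt_of_le (hs (Fin.castSucc_lt_last i)) hx
      have hS := sparse_ne_zero k g B P hPdef hP
        (insert x (Finset.univ.image fun i : Fin k => s i.castSucc)) (by
          intro y hy
          rw [Finset.mem_insert] at hy
          rcases hy with rfl | hy
          · exact ⟨(hs0 _).trans_le hx, h0⟩
          · simp only [Finset.mem_image, Finset.mem_univ, true_and] at hy
            obtain ⟨i, rfl⟩ := hy
            exact ⟨hs0 _, hroot i⟩)
      rw [Finset.card_insert_of_notMem, Finset.card_image_of_injective] at hS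
      · simp at hS
      · exact (hs.comp (Fin.strictMono_castSucc)).injective
      · simp only [Finset.mem_image, Finset.mem_univ, true_and, not_exists]
        intro i hi
        exact (hlt i).ne hi
    have hfin : (Matrix.of fun i j => s i ^ g j).det = P.eval (s (Fin.last k)) := by
      rw [hPe, ← hexp]
      congr
      ext i j
      refine Fin.lastCases ?_ (fun i => ?_) i <;> simp
    rw [hfin]
    by_contra hneg
    have hneg : P.eval (s (Fin.last k)) < 0 :=
      lt_of_le_of_ne (not_lt.mp hneg) (hnoroot _ le_rfl)
    have hpos : ∃ x, s (Fin.last k) ≤ x ∧ 0 < P.eval x := by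
      by_cases hd : 0 < P.degree
      · have ht := Polynomial.tendsto_atTop_of_leadingCoeff_nonneg P hd (by rw [hlead]; exact hBl.le)
        obtain ⟨x, hx⟩ := ((ht.eventually_gt_atTop 0).and
          (Filter.eventually_ge_atTop (s (Fin.last k)))).exists
        exact ⟨x, hx.2, hx.1⟩
      · refine ⟨s (Fin.last k), le_rfl, ?_⟩
        have hC := Polynomial.eq_C_of_degree_le_zero (not_lt.mp hd)
        have : P.coeff 0 = P.leadingCoeff := by
          rw [hC]; simp
        rw [hC, Polynomial.eval_C, this, hlead]
        exact hBl
    obtain ⟨x, hx, hxp⟩ := hpos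
    obtain ⟨y, hy, hy0⟩ := intermediate_value_Icc hx (P.continuous.continuousOn)
      (show (0 : ℝ) ∈ Set.Icc _ _ from ⟨hneg.le, hxp.le⟩)
    exact hnoroot y hy.1 hy0

lemma det_mul_expand (k N : ℕ) (A : Matrix (Fin k) (Fin N) ℝ) (B : Matrix (Fin N) (Fin k) ℝ) :
    (A * B).det = ∑ h : Fin k → Fin N, (∏ i, A i (h i)) * (B.submatrix h id).det := by
  have h1 : (A * B).det = Matrix.detRowAlternating (fun i => ∑ m : Fin N, A i m • B m) := by
    change _ = Matrix.det _
    congr 1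
    ext i j
    simp [Matrix.mul_apply]
  rw [h1]
  have := (Matrix.detRowAlternating (n := Fin k) (R := ℝ)).toMultilinearMap.map_sum
    (fun (i : Fin k) (m : Fin N) => A i m • B m)
  refine this.trans ?_
  refine Finset.sum_congr rfl fun h _ => ?_
  refine ((Matrix.detRowAlternating (n := Fin k) (R := ℝ)).toMultilinearMap.map_smul_univ
    (fun i => A i (h i)) (fun i => B (h i))).trans ?_
  rfl

lemma cauchyBinet_sym (k N : ℕ) (A : Matrix (Fin k) (Fin N) ℝ) (B : Matrix (Fin N) (Fin k) ℝ) :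
    (k.factorial : ℝ) * (A * B).det =
      ∑ h : Fin k → Fin N, (A.submatrix id h).det * (B.submatrix h id).det := by
  have key : ∀ σ : Equiv.Perm (Fin k), (A * B).det =
      ∑ h : Fin k → Fin N, ((Equiv.Perm.sign σ : ℤ) : ℝ) * (∏ i, A i (h (σ i))) *
        (B.submatrix h id).det := by
    intro σ
    rw [det_mul_expand]
    refine (Equiv.sum_comp (Equiv.arrowCongr σ.symm (Equiv.refl (Fin N)))
      (fun h : Fin k → Fin N => (∏ i, A i (h i)) * (B.submatrix h id).det)).symm.trans ?_
    refine Finset.sum_congr rfl fun h _ => ?_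
    have h2 : (B.submatrix (fun i => h (σ i)) id).det =
        ((Equiv.Perm.sign σ : ℤ) : ℝ) * (B.submatrix h id).det := by
      have := Matrix.det_permute σ (B.submatrix h id)
      rw [← this]; rfl
    change (∏ i, A i (h (σ i))) * (B.submatrix (fun i => h (σ i)) id).det = _
    rw [h2]; ring
  have h3 : ∑ _σ : Equiv.Perm (Fin k), (A * B).det = (k.factorial : ℝ) * (A * B).det := by
    simp [Fintype.card_perm]
  rw [← h3, Finset.sum_congr rfl (fun σ _ => key σ), Finset.sum_comm]
  refine Finset.sum_congr rfl fun h _ => ?_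
  rw [← Finset.sum_mul]
  congr 1
  rw [← Matrix.det_transpose, Matrix.det_apply']
  rfl

lemma cb_term_nonneg (k N : ℕ) (A : Matrix (Fin k) (Fin N) ℝ) (B : Matrix (Fin N) (Fin k) ℝ)
    (hA : ∀ h : Fin k → Fin N, StrictMono h → 0 ≤ (A.submatrix id h).det)
    (hB : ∀ h : Fin k → Fin N, StrictMono h → 0 ≤ (B.submatrix h id).det)
    (h : Fin k → Fin N) : 0 ≤ (A.submatrix id h).det * (B.submatrix h id).det := by
  by_cases hi : Function.Injective h
  · set σ := Tuple.sort h
    have hm : StrictMono (h ∘ σ) :=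
      (Tuple.monotone_sort h).strictMono_of_injective (hi.comp σ.injective)
    have h1 : (A.submatrix id (h ∘ σ)).det =
        ((Equiv.Perm.sign σ : ℤ) : ℝ) * (A.submatrix id h).det := by
      rw [← Matrix.det_permute' σ (A.submatrix id h)]; rfl
    have h2 : (B.submatrix (h ∘ σ) id).det =
        ((Equiv.Perm.sign σ : ℤ) : ℝ) * (B.submatrix h id).det := by
      rw [← Matrix.det_permute σ (B.submatrix h id)]; rfl
    have h3 := mul_nonneg (hA _ hm) (hB _ hm)
    rw [h1, h2] at h3
    have h4 : ((Equiv.Perm.sign σ : ℤ) : ℝ) * ((Equiv.Perm.sign σ : ℤ) : ℝ) = 1 := by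
      rcases Int.units_eq_one_or (Equiv.Perm.sign σ) with h | h <;> simp [h]
    calc (0:ℝ) ≤ _ := h3
      _ = (((Equiv.Perm.sign σ : ℤ) : ℝ) * ((Equiv.Perm.sign σ : ℤ) : ℝ)) *
        ((A.submatrix id h).det * (B.submatrix h id).det) := by ring
      _ = _ := by rw [h4, one_mul]
  · rw [Function.not_injective_iff] at hi
    obtain ⟨a, b, hab, hne⟩ := hi
    have : (B.submatrix h id).det = 0 := by
      refine Matrix.det_zero_of_row_eq hne ?_
      ext j; simp [Matrix.submatrix_apply, hab]
    rw [this, mul_zero]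

lemma cb_nonneg (k N : ℕ) (A : Matrix (Fin k) (Fin N) ℝ) (B : Matrix (Fin N) (Fin k) ℝ)
    (hA : ∀ h : Fin k → Fin N, StrictMono h → 0 ≤ (A.submatrix id h).det)
    (hB : ∀ h : Fin k → Fin N, StrictMono h → 0 ≤ (B.submatrix h id).det) :
    0 ≤ (A * B).det := by
  have h1 := cauchyBinet_sym k N A B
  have h2 : 0 ≤ (k.factorial : ℝ) * (A * B).det := by
    rw [h1]; exact Finset.sum_nonneg fun h _ => cb_term_nonneg k N A B hA hB h
  have h3 : (0:ℝ) < k.factorial := by exact_mod_cast k.factorial_pos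
  exact nonneg_of_mul_nonneg_right h2 h3

lemma cb_pos (k N : ℕ) (A : Matrix (Fin k) (Fin N) ℝ) (B : Matrix (Fin N) (Fin k) ℝ)
    (hA : ∀ h : Fin k → Fin N, StrictMono h → 0 ≤ (A.submatrix id h).det)
    (hB : ∀ h : Fin k → Fin N, StrictMono h → 0 ≤ (B.submatrix h id).det)
    (h0 : Fin k → Fin N) (hA0 : 0 < (A.submatrix id h0).det)
    (hB0 : 0 < (B.submatrix h0 id).det) :
    0 < (A * B).det := by
  have h1 := cauchyBinet_sym k N A B
  have h2 : 0 < (k.factorial : ℝ) * (A * B).det := by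
    rw [h1]
    exact Finset.sum_pos' (fun h _ => cb_term_nonneg k N A B hA hB h)
      ⟨h0, Finset.mem_univ _, mul_pos hA0 hB0⟩
  have h3 : (0:ℝ) < k.factorial := by exact_mod_cast k.factorial_pos
  exact pos_of_mul_pos_right h2 h3.le

/-- Total nonnegativity of an infinite array, restricted to columns below `K`. -/
def TNb (K : ℕ) (G : ℕ → ℕ → ℝ) : Prop :=
  ∀ (k : ℕ) (f g : Fin k → ℕ), StrictMono f → StrictMono g → (∀ j, g j < K) →
    0 ≤ (Matrix.of fun i j => G (f i) (g j)).det

lemma det_first_row (k : ℕ) (M : Matrix (Fin (k + 1)) (Fin (k + 1)) ℝ)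
    (h : ∀ j : Fin k, M 0 j.succ = 0) :
    M.det = M 0 0 * (M.submatrix Fin.succ Fin.succ).det := by
  rw [Matrix.det_succ_row_zero, Fin.sum_univ_succ]
  simp [h, Fin.succAbove_zero]

lemma ones_TN (k : ℕ) : ∀ (f g : Fin k → ℕ), StrictMono f → StrictMono g →
    0 ≤ (Matrix.of fun i j => if g j ≤ f i then (1 : ℝ) else 0).det := by
  induction k with
  | zero => intro f g _ _; simp
  | succ k ih =>
    intro f g hf hg
    by_cases h1 : ∀ j : Fin k, f 0 < g j.succ
    · rw [det_first_row]
      · refine mul_nonneg ?_ (ih (fun i => f i.succ) (fun i => g i.succ)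
          (hf.comp (Fin.strictMono_succ)) (hg.comp (Fin.strictMono_succ)))
        simp only [Matrix.of_apply]
        split_ifs <;> norm_num
      · intro j
        simp [h1 j]
    · push Not at h1
      obtain ⟨j, hj⟩ := h1
      refine (Matrix.det_zero_of_column_eq (i := 0) (j := j.succ) (Fin.succ_ne_zero j).symm ?_).ge
      intro i
      have h2 : f 0 ≤ f i := hf.monotone (Fin.zero_le i)
      have h3 : g 0 ≤ g j.succ := hg.monotone (Fin.zero_le _)
      simp only [Matrix.of_apply]
      rw [if_pos (by omega), if_pos (by omega)]

lemma sum_TN (K : ℕ) (X : ℕ → ℕ → ℝ) (hX : TNb K X) :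
    TNb K (fun l k => ∑ i ∈ Finset.range (l + 1), X i k) := by
  intro k f g hf hg hK
  set N := (∑ i, f i) + 1 with hN
  have hfN : ∀ i, f i + 1 ≤ N := fun i => by
    have := Finset.single_le_sum (f := f) (fun i _ => Nat.zero_le _) (Finset.mem_univ i)
    omega
  have : (Matrix.of fun i j => ∑ m ∈ Finset.range (f i + 1), X m (g j)) =
      (Matrix.of fun (i : Fin k) (m : Fin N) => if (m : ℕ) ≤ f i then (1 : ℝ) else 0) *
      (Matrix.of fun (m : Fin N) (j : Fin k) => X m (g j)) := by
    ext i j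
    simp only [Matrix.mul_apply, Matrix.of_apply]
    rw [Fin.sum_univ_eq_sum_range (fun m => (if m ≤ f i then (1:ℝ) else 0) * X m (g j)) N]
    rw [← Finset.sum_subset (Finset.range_subset_range.mpr (hfN i))]
    · refine Finset.sum_congr rfl fun m hm => ?_
      rw [Finset.mem_range] at hm
      rw [if_pos (by omega), one_mul]
    · intro m _ hm
      rw [Finset.mem_range] at hm
      rw [if_neg (by omega), zero_mul]
  rw [this]
  apply cb_nonneg
  · intro h hh
    exact ones_TN k f (fun i => (h i : ℕ)) hf (fun a b hab => hh hab)
  · intro h hh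
    exact hX k (fun i => (h i : ℕ)) g (fun a b hab => hh hab) hg hK

/-- prepend the row `e_r` to a scaled array -/
def consRow (r : ℕ) (d : ℕ → ℝ) (G : ℕ → ℕ → ℝ) : ℕ → ℕ → ℝ
  | 0, k => if k = r then 1 else 0
  | i + 1, k => d i * G i k

lemma det_row_scale (k : ℕ) (d : Fin k → ℝ) (M : Matrix (Fin k) (Fin k) ℝ) :
    (Matrix.of fun i j => d i * M i j).det = (∏ i, d i) * M.det :=
  Matrix.det_mul_column d M

lemma consRow_TN_aux (K r : ℕ) (d : ℕ → ℝ) (hd : ∀ i, 0 ≤ d i) (G : ℕ → ℕ → ℝ) (hG : TNb K G)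
    (k : ℕ) (f g : Fin k → ℕ) (hf : StrictMono f) (hg : StrictMono g) (hK : ∀ j, g j < K)
    (hf0 : ∀ i, f i ≠ 0) : 0 ≤ (Matrix.of fun i j => consRow r d G (f i) (g j)).det := by
  have : (Matrix.of fun i j => consRow r d G (f i) (g j)) =
      Matrix.of fun i j => d (f i - 1) *
        (Matrix.of (fun i j => G (f i - 1) (g j)) : Matrix (Fin k) (Fin k) ℝ) i j := by
    ext i j
    obtain ⟨m, hm⟩ := Nat.exists_eq_succ_of_ne_zero (hf0 i)
    simp [hm, consRow]
  rw [this, det_row_scale]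
  refine mul_nonneg (Finset.prod_nonneg fun i _ => hd _) (hG k (fun i => f i - 1) g ?_ hg hK)
  intro a b hab
  have := hf hab
  have := hf0 a
  show f a - 1 < f b - 1
  omega

lemma consRow_TN (K r : ℕ) (d : ℕ → ℝ) (hd : ∀ i, 0 ≤ d i) (G : ℕ → ℕ → ℝ) (hG : TNb K G)
    (hG0 : ∀ i k, k ≤ r → G i k = 0) : TNb K (consRow r d G) := by
  intro k f g hf hg hK
  by_cases hf0 : ∀ i, f i ≠ 0
  · exact consRow_TN_aux K r d hd G hG k f g hf hg hK hf0
  · push Not at hf0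
    obtain ⟨i0, hi0⟩ := hf0
    obtain _ | k := k
    · exact i0.elim0
    have hf00 : f 0 = 0 := by
      have := hf.monotone (Fin.zero_le i0)
      omega
    by_cases hgr : g 0 < r
    · refine (Matrix.det_eq_zero_of_column_eq_zero 0 ?_).ge
      intro i
      simp only [Matrix.of_apply]
      cases hfi : f i with
      | zero => simp [consRow, hgr.ne]
      | succ m => simp [consRow, hG0 m _ hgr.le]
    · rw [det_first_row]
      · refine mul_nonneg ?_ ?_
        · simp only [Matrix.of_apply, hf00, consRow]
          split_ifs <;> norm_num
        · refine consRow_TN_aux K r d hd G hG k (fun i => f i.succ) (fun i => g i.succ)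
            (hf.comp (Fin.strictMono_succ)) (hg.comp (Fin.strictMono_succ)) (fun j => hK _) ?_
          intro i
          have := hf (Fin.succ_pos i)
          show f i.succ ≠ 0
          omega
      · intro j
        have := hg (Fin.succ_pos j)
        simp only [Matrix.of_apply, hf00, consRow]
        rw [if_neg (by omega)]

/-- Divided differences of the Newton basis: `MM z k r l = N_k[z_l, …, z_{l+r}]`. -/
def MM (z : ℕ → ℝ) : ℕ → ℕ → ℕ → ℝ
  | 0, 0, _ => 1
  | 0, _ + 1, _ => 0
  | k + 1, 0, l => (z l - z k) * MM z k 0 l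
  | k + 1, r + 1, l => (z (l + r + 1) - z k) * MM z k (r + 1) l + MM z k r l

lemma MM_diff (z : ℕ → ℝ) (k : ℕ) : ∀ r l, MM z k r (l + 1) - MM z k r l =
    (z (l + r + 1) - z l) * MM z k (r + 1) l := by
  induction k with
  | zero => intro r l; cases r <;> simp [MM]
  | succ k ih =>
    intro r l
    cases r with
    | zero =>
      have h := ih 0 l
      simp only [MM, Nat.add_zero] at h ⊢
      linear_combination (z (l + 1) - z k) * h
    | succ r =>
      have h := ih (r + 1) l
      have h' := ih r l
      simp only [MM] at h ⊢
      have e : l + 1 + r + 1 = l + (r + 1) + 1 := by omega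
      have e' : l + r + 1 = l + (r + 1) := by omega
      rw [e, e'] at *
      linear_combination (z (l + (r + 1) + 1) - z k) * h + h'

lemma MM_zero_of_lt (z : ℕ → ℝ) (k : ℕ) : ∀ r l, k < r → MM z k r l = 0 := by
  induction k with
  | zero => intro r l h; cases r with
    | zero => omega
    | succ r => simp [MM]
  | succ k ih =>
    intro r l h
    cases r with
    | zero => omega
    | succ r => simp [MM, ih (r + 1) l (by omega), ih r l (by omega)]

lemma MM_row_zero (z : ℕ → ℝ) (k : ℕ) : ∀ r, MM z k r 0 = if k = r then 1 else 0 := by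
  induction k with
  | zero => intro r; cases r <;> simp [MM]
  | succ k ih =>
    intro r
    cases r with
    | zero =>
      simp only [MM, ih]
      by_cases h : k = 0 <;> simp [h]
    | succ r =>
      simp only [MM, ih]
      by_cases h : k = r
      · simp [h]
      · by_cases h2 : k = r + 1
        · subst h2; simp
        · simp [h, h2]

lemma MM_eq_sum (z : ℕ → ℝ) (k r l : ℕ) : MM z k r l = ∑ i ∈ Finset.range (l + 1),
    consRow r (fun i => z (i + r + 1) - z i) (fun i k => MM z k (r + 1) i) i k := by
  induction l with
  | zero => simp [consRow, MM_row_zero]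
  | succ l ih =>
    rw [Finset.sum_range_succ, ← ih]
    simp only [consRow]
    linear_combination MM_diff z k r l

lemma MM_TN (z : ℕ → ℝ) (hz : StrictMono z) (K : ℕ) : ∀ c r, K ≤ r + c →
    TNb K (fun l k => MM z k r l) := by
  intro c
  induction c with
  | zero =>
    intro r hr k f g hf hg hK
    cases k with
    | zero => simp
    | succ k =>
      refine (Matrix.det_eq_zero_of_column_eq_zero 0 ?_).ge
      intro i
      simp only [Matrix.of_apply]
      exact MM_zero_of_lt z _ _ _ (by have := hK 0; omega)
  | succ c ih =>
    intro r hr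
    have h := sum_TN K _ (consRow_TN K r (fun i => z (i + r + 1) - z i)
      (fun i => sub_nonneg.mpr (hz.monotone (by omega))) (fun i k => MM z k (r + 1) i)
      (ih (r + 1) (by omega)) (fun i k hk => MM_zero_of_lt z _ _ _ (by omega)))
    simpa only [← MM_eq_sum] using h

lemma MM_newton (z : ℕ → ℝ) (k l : ℕ) : MM z k 0 l = ∏ i ∈ Finset.range k, (z l - z i) := by
  induction k with
  | zero => simp [MM]
  | succ k ih => rw [Finset.prod_range_succ, MM, ih, mul_comm]

lemma qInt_pos (q : ℝ) (hq : 0 < q) (m : ℕ) : 0 < qInt q (m + 1) := by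
  unfold qInt
  exact Finset.sum_pos (fun i _ => pow_pos hq i) ⟨0, by simp⟩

lemma qInt_succ (q : ℝ) (m : ℕ) : qInt q (m + 1) = qInt q m + q ^ m := by
  unfold qInt; rw [Finset.sum_range_succ]

lemma qInt_add (q : ℝ) (a b : ℕ) : qInt q (a + b) = qInt q a + q ^ a * qInt q b := by
  induction b with
  | zero => simp [qInt]
  | succ b ih => rw [← add_assoc, qInt_succ, ih, qInt_succ, pow_add]; ring

/-- coefficients in the q-binomial theorem -/
noncomputable def SS (q : ℝ) (p k : ℕ) : ℝ :=
  ∏ i ∈ Finset.range k, (q ^ (i + 1) * qInt q (p - i) / qInt q (i + 1))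

lemma SS_shift (q : ℝ) (hq : 0 < q) (p k : ℕ) :
    SS q (p + 1) (k + 1) = SS q p k * (q ^ (k + 1) * qInt q (p + 1) / qInt q (k + 1)) := by
  induction k with
  | zero => simp [SS]
  | succ k ih =>
    rw [SS, Finset.prod_range_succ, ← SS, ih, SS, SS, Finset.prod_range_succ]
    have h1 := (qInt_pos q hq k).ne'
    have h2 := (qInt_pos q hq (k + 1)).ne'
    have e : p + 1 - (k + 1) = p - k := by omega
    rw [e]
    field_simp

lemma SS_rec (q : ℝ) (hq : 0 < q) (p k : ℕ) (hk : k ≤ p) :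
    SS q (p + 1) (k + 1) = SS q p (k + 1) + q ^ (p + 1) * SS q p k := by
  rw [SS_shift q hq]
  have h3 : SS q p (k + 1) = SS q p k * (q ^ (k + 1) * qInt q (p - k) / qInt q (k + 1)) := by
    rw [SS, Finset.prod_range_succ, ← SS]
  rw [h3]
  have h1 := (qInt_pos q hq k).ne'
  obtain ⟨m, rfl⟩ := Nat.exists_eq_add_of_le hk
  have e : k + m - k = m := by omega
  have e2 : k + m + 1 = m + (k + 1) := by omega
  rw [e, e2, qInt_add q m (k + 1)]
  field_simp
  ring

lemma SS_zero (q : ℝ) (p : ℕ) : SS q p (p + 1) = 0 := by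
  rw [SS, Finset.prod_range_succ]; simp [qInt]

lemma q_binomial (q : ℝ) (hq : 0 < q) (x : ℝ) (p : ℕ) :
    ∑ k ∈ Finset.range (p + 1), x ^ k * SS q p k = ∏ j ∈ Finset.Icc 1 p, (1 + q ^ j * x) := by
  induction p with
  | zero => simp [SS]
  | succ p ih =>
    rw [Finset.prod_Icc_succ_top (by omega), ← ih, Finset.sum_range_succ']
    have h1 : ∑ k ∈ Finset.range (p + 1), x ^ (k + 1) * SS q (p + 1) (k + 1) =
        ∑ k ∈ Finset.range (p + 1), x ^ (k + 1) * SS q p (k + 1) +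
        q ^ (p + 1) * x * ∑ k ∈ Finset.range (p + 1), x ^ k * SS q p k := by
      rw [Finset.mul_sum, ← Finset.sum_add_distrib]
      refine Finset.sum_congr rfl fun k hk => ?_
      rw [Finset.mem_range] at hk
      rw [SS_rec q hq p k (by omega)]
      ring
    have h2 : ∑ k ∈ Finset.range (p + 1), x ^ (k + 1) * SS q p (k + 1) + 1 =
        ∑ k ∈ Finset.range (p + 1), x ^ k * SS q p k := by
      have h3 := Finset.sum_range_succ (fun k => x ^ k * SS q p k) (p + 1)
      rw [SS_zero, mul_zero, add_zero, Finset.sum_range_succ'] at h3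
      rw [← h3]; simp [SS]
    rw [h1]
    have h4 : x ^ 0 * SS q (p + 1) 0 = 1 := by simp [SS]
    rw [h4]
    linear_combination h2

/-- the Newton nodes -/
noncomputable def zz (q : ℝ) (p : ℕ) : ℝ := -(1 / qInt q (p + 1))

lemma zz_strictMono (q : ℝ) (hq : 0 < q) : StrictMono (zz q) := by
  refine strictMono_nat_of_lt_succ fun p => ?_
  have h1 := qInt_pos q hq p
  have h2 : qInt q (p + 1) < qInt q (p + 1 + 1) := by
    rw [qInt_succ q (p + 1)]
    have := pow_pos hq (p + 1)
    linarith
  unfold zz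
  exact neg_lt_neg (one_div_lt_one_div_of_lt h1 h2)

lemma zz_sub (q : ℝ) (hq : 0 < q) (p i : ℕ) (hi : i ≤ p) :
    zz q p - zz q i = q ^ (i + 1) * qInt q (p - i) / qInt q (i + 1) / qInt q (p + 1) := by
  have h1 := (qInt_pos q hq p).ne'
  have h2 := (qInt_pos q hq i).ne'
  have h3 := qInt_add q (i + 1) (p - i)
  have e : i + 1 + (p - i) = p + 1 := by omega
  rw [e] at h3
  unfold zz
  field_simp
  linear_combination h3

lemma newton_sum (q : ℝ) (hq : 0 < q) (u : ℝ) (p : ℕ) :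
    ∑ k ∈ Finset.range (p + 1), u ^ k * MM (zz q) k 0 p =
      ∏ j ∈ Finset.Icc 1 p, (1 + q ^ j * (u / qInt q (p + 1))) := by
  rw [← q_binomial q hq]
  refine Finset.sum_congr rfl fun k hk => ?_
  rw [Finset.mem_range] at hk
  rw [MM_newton, div_pow, SS]
  have : ∏ i ∈ Finset.range k, (zz q p - zz q i) = ∏ i ∈ Finset.range k,
      (q ^ (i + 1) * qInt q (p - i) / qInt q (i + 1) / qInt q (p + 1)) := by
    refine Finset.prod_congr rfl fun i hi => ?_
    rw [Finset.mem_range] at hi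
    exact zz_sub q hq p i (by omega)
  rw [this, Finset.prod_div_distrib (g := fun _ => qInt q (p + 1)), Finset.prod_const,
    Finset.card_range]
  ring

lemma MM_upper (z : ℕ → ℝ) (k l : ℕ) (h : l < k) : MM z k 0 l = 0 := by
  rw [MM_newton]
  exact Finset.prod_eq_zero (Finset.mem_range.mpr h) (sub_self _)

/-- prepend a zero column -/
def shiftCol (G : ℕ → ℕ → ℝ) : ℕ → ℕ → ℝ
  | _, 0 => 0
  | i, k + 1 => G i k

lemma shiftCol_TN (K : ℕ) (G : ℕ → ℕ → ℝ) (hG : TNb K G) : TNb (K + 1) (shiftCol G) := by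
  intro k f g hf hg hK
  by_cases h0 : ∃ j, g j = 0
  · obtain ⟨j, hj⟩ := h0
    refine (Matrix.det_eq_zero_of_column_eq_zero j ?_).ge
    intro i
    simp [hj, shiftCol]
  · push Not at h0
    have : (Matrix.of fun i j => shiftCol G (f i) (g j)) =
        Matrix.of fun i j => G (f i) (g j - 1) := by
      ext i j
      obtain ⟨m, hm⟩ := Nat.exists_eq_succ_of_ne_zero (h0 j)
      simp [hm, shiftCol]
    rw [this]
    refine hG k f (fun j => g j - 1) hf ?_ ?_
    · intro a b hab
      have := hg hab
      have := h0 a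
      show g a - 1 < g b - 1
      omega
    · intro j
      have := hK j
      have := h0 j
      show g j - 1 < K
      omega

/-- the change of basis array (rows: q-Abel index, columns: powers) -/
noncomputable def XX (q α : ℝ) : ℕ → ℕ → ℝ :=
  consRow 0 (fun p => α * (α * qInt q (p + 1)) ^ p) (shiftCol fun l k => MM (zz q) k 0 l)

lemma XX_TN (q α : ℝ) (hq : 0 < q) (hα : 0 < α) (K : ℕ) : TNb (K + 1) (XX q α) := by
  refine consRow_TN _ _ _ ?_ _ (shiftCol_TN K _ (MM_TN (zz q) (zz_strictMono q hq) K K 0 (by omega))) ?_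
  · intro p
    have := qInt_pos q hq p
    positivity
  · intro i k hk
    obtain rfl : k = 0 := by omega
    rfl

lemma XX_upper (q α : ℝ) (j k : ℕ) (h : j < k) : XX q α j k = 0 := by
  cases k with
  | zero => omega
  | succ k => cases j with
    | zero => simp [XX, consRow]
    | succ j => simp [XX, consRow, shiftCol, MM_upper (zz q) k j (by omega)]

lemma XX_diag (q α : ℝ) (hq : 0 < q) (hα : 0 < α) (j : ℕ) : 0 < XX q α j j := by
  cases j with
  | zero => simp [XX, consRow]
  | succ j =>
    simp only [XX, consRow, shiftCol, MM_newton]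
    have := qInt_pos q hq j
    have h2 : 0 < ∏ i ∈ Finset.range j, (zz q j - zz q i) := by
      refine Finset.prod_pos fun i hi => sub_pos.mpr (zz_strictMono q hq (Finset.mem_range.mp hi))
    positivity

lemma qAbel_expand (q α : ℝ) (hq : 0 < q) (hα : 0 < α) (u : ℝ) (n j : ℕ) (hj : j ≤ n) :
    qAbel q α j (-(α * u)) * (-1) ^ j = ∑ k ∈ Finset.range (n + 1), u ^ k * XX q α j k := by
  cases j with
  | zero => rw [Finset.sum_range_succ']; simp [qAbel, XX, consRow]
  | succ p =>
    have h0 := qInt_pos q hq p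
    have h1 : ∑ k ∈ Finset.range (n + 1), u ^ k * XX q α (p + 1) k =
        α * (α * qInt q (p + 1)) ^ p * u *
          ∑ k ∈ Finset.range (p + 1), u ^ k * MM (zz q) k 0 p := by
      rw [Finset.sum_range_succ']
      have : ∑ k ∈ Finset.range (p + 1), u ^ k * MM (zz q) k 0 p =
          ∑ k ∈ Finset.range n, u ^ k * MM (zz q) k 0 p := by
        refine Finset.sum_subset (Finset.range_subset_range.mpr hj) ?_
        intro k _ hk
        rw [Finset.mem_range] at hk
        rw [MM_upper _ _ _ (by omega), mul_zero]
      rw [this, Finset.mul_sum]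
      simp only [XX, consRow, shiftCol, mul_zero, add_zero]
      refine Finset.sum_congr rfl fun k _ => ?_
      ring
    rw [h1, newton_sum q hq]
    have h2 : (α * qInt q (p + 1)) ^ p * ∏ j ∈ Finset.Icc 1 p, (1 + q ^ j * (u / qInt q (p + 1))) =
        (-1) ^ p * ∏ j ∈ Finset.Icc 1 p, (-(α * u) * q ^ j - α * qInt q (p + 1)) := by
      have hc : p = (Finset.Icc 1 p).card := by simp
      conv_lhs => rw [hc]; simp only [Nat.card_Icc, Nat.add_sub_cancel]
      have e1 : (α * qInt q (p + 1)) ^ p = ∏ j ∈ Finset.Icc 1 p, (α * qInt q (p + 1)) := by simp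
      have e2 : ((-1 : ℝ)) ^ p = ∏ j ∈ Finset.Icc 1 p, (-1 : ℝ) := by simp
      rw [e1, e2, ← Finset.prod_mul_distrib, ← Finset.prod_mul_distrib]
      refine Finset.prod_congr rfl fun j _ => ?_
      field_simp
      ring
    simp only [qAbel, Nat.add_sub_cancel, if_neg (Nat.succ_ne_zero p)]
    rw [pow_succ]
    linear_combination (-(α * u)) * h2

lemma qAbel_alpha_zero (q : ℝ) (s : ℝ) (j : ℕ) :
    qAbel q 0 j (-s) * (-1) ^ j = (∏ i ∈ Finset.Icc 1 (j - 1), q ^ i) * s ^ j := by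
  cases j with
  | zero => simp [qAbel]
  | succ p =>
    simp only [qAbel, Nat.add_sub_cancel, if_neg (Nat.succ_ne_zero p), zero_mul, sub_zero]
    rw [Finset.prod_mul_distrib, Finset.prod_const, Nat.card_Icc, Nat.add_sub_cancel, neg_pow s p]
    have : ((-1 : ℝ)) ^ p * (-1) ^ p = 1 := by rw [← mul_pow]; norm_num
    rw [pow_succ, pow_succ]
    linear_combination (s * s ^ p * ∏ i ∈ Finset.Icc 1 p, q ^ i) * this

theorem qAbel_collocationJ_strictTotallyPos (q α : ℝ) (hq : 0 < q) (hα : 0 ≤ α)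
    (n : ℕ) (t : Fin (n + 1) → ℝ) (ht0 : t 0 < 0) (ht : StrictAnti t) :
    IsStrictTotallyPos
      ((Matrix.of fun i j : Fin (n + 1) => qAbel q α (j : ℕ) (t i)) * Jmat n) := by
  intro k f g hf hg
  have htneg : ∀ i, t i < 0 := fun i => (ht.antitone (Fin.zero_le i)).trans_lt ht0
  have hentry : ((Matrix.of fun i j : Fin (n + 1) => qAbel q α (j : ℕ) (t i)) * Jmat n).submatrix f g
      = Matrix.of fun i j => qAbel q α (g j : ℕ) (t (f i)) * (-1) ^ (g j : ℕ) := by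
    ext i j
    simp [Jmat, Matrix.mul_diagonal]
  rw [hentry]
  have hgN : StrictMono (fun j => (g j : ℕ)) := fun a b hab => hg hab
  rcases hα.eq_or_lt with rfl | hα
  · have : (Matrix.of fun i j => qAbel q 0 (g j : ℕ) (t (f i)) * (-1) ^ (g j : ℕ)) =
        Matrix.of fun i j => (∏ m ∈ Finset.Icc 1 ((g j : ℕ) - 1), q ^ m) *
          (Matrix.of (fun i j => (-t (f i)) ^ (g j : ℕ)) : Matrix (Fin k) (Fin k) ℝ) i j := by
      ext i j
      have := qAbel_alpha_zero q (-t (f i)) (g j)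
      rw [neg_neg] at this
      simp only [Matrix.of_apply]
      rw [this]
    rw [this, Matrix.det_mul_row]
    refine mul_pos (Finset.prod_pos fun j _ => Finset.prod_pos fun m _ => pow_pos hq m) ?_
    exact genVand_pos k (fun i => -t (f i)) (fun j => (g j : ℕ)) (fun i => neg_pos.mpr (htneg _))
      (fun a b hab => neg_lt_neg (ht (hf hab))) hgN
  · set u : Fin k → ℝ := fun i => -t (f i) / α with hu
    have hu0 : ∀ i, 0 < u i := fun i => div_pos (neg_pos.mpr (htneg _)) hα
    have hum : StrictMono u := fun a b hab =>
      div_lt_div_of_pos_right (neg_lt_neg (ht (hf hab))) hα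
    have : (Matrix.of fun i j => qAbel q α (g j : ℕ) (t (f i)) * (-1) ^ (g j : ℕ)) =
        (Matrix.of fun (i : Fin k) (m : Fin (n + 1)) => u i ^ (m : ℕ)) *
        (Matrix.of fun (m : Fin (n + 1)) (j : Fin k) => XX q α (g j) m) := by
      ext i j
      have h1 := qAbel_expand q α hq hα (u i) n (g j) (by have := (g j).isLt; omega)
      have h2 : -(α * u i) = t (f i) := by simp only [hu]; field_simp
      rw [h2] at h1
      simp only [Matrix.mul_apply, Matrix.of_apply]
      rw [h1, Fin.sum_univ_eq_sum_range (fun m => u i ^ m * XX q α (g j) m) (n + 1)]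
    rw [this]
    have hV : ∀ h : Fin k → Fin (n + 1), StrictMono h →
        0 < ((Matrix.of fun (i : Fin k) (m : Fin (n + 1)) => u i ^ (m : ℕ)).submatrix id h).det :=
      fun h hh => genVand_pos k u (fun j => (h j : ℕ)) hu0 hum (fun a b hab => hh hab)
    refine cb_pos k (n + 1) _ _ (fun h hh => (hV h hh).le) ?_ g (hV g hg) ?_
    · intro h hh
      rw [← Matrix.det_transpose]
      exact XX_TN q α hq hα n k (fun j => (g j : ℕ)) (fun j => (h j : ℕ)) hgN
        (fun a b hab => hh hab) (fun j => (h j).isLt)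
    · rw [Matrix.det_of_upperTriangular]
      · exact Finset.prod_pos fun j _ => XX_diag q α hq hα _
      · intro a b hab
        exact XX_upper q α _ _ (hgN hab)
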